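/- Let Γ be a finite connected simple cubic vertex-transitive graph of girth 6 with signature (a, b, c) where b = c = 5. Then a = 4 and Γ is isomorphic to Ψ_9 = Cay(D_9, {τ_0, τ_1, τ_3}). -/

import Mathlib

/-- The Cayley graph of a group on a (symmetric) connection set `S`:
distinct `g, h` are adjacent iff `g * h⁻¹ ∈ S`. -/
def cayley {G : Type*} [Group G] (S : Set G) : SimpleGraph G :=
  SimpleGraph.fromRel (fun x y => x * y⁻¹ ∈ S)

/-- In the dihedral group `D_n = ⟨ρ, τ⟩`, the element `τ_i = ρ^i * τ`. -/
def dihTau {n : ℕ} (i : ℕ) : DihedralGroup n :=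
  (DihedralGroup.r 1) ^ i * DihedralGroup.sr 0

/-- The number of cycles of length 6 in `G` (identified with their edge sets)
that contain the edge `e`. -/
noncomputable def sixCycleCount {V : Type*} (G : SimpleGraph V) (e : Sym2 V) : ℕ :=
  Set.ncard {s : Set (Sym2 V) |
    (∃ (v : V) (w : G.Walk v v), w.IsCycle ∧ w.length = 6 ∧ s = {e' | e' ∈ w.edges}) ∧ e ∈ s}

/-- A cubic graph of girth 6 is girth-regular with signature `(a, b, c)` if every vertex is
incident with exactly three edges, on which the numbers of girth cycles (6-cycles) are
`a`, `b`, `c` respectively. -/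
def hasSignature {V : Type*} (G : SimpleGraph V) (a b c : ℕ) : Prop :=
  ∀ v : V, ∃ e₁ e₂ e₃ : Sym2 V, e₁ ≠ e₂ ∧ e₁ ≠ e₃ ∧ e₂ ≠ e₃ ∧
    G.incidenceSet v = {e₁, e₂, e₃} ∧
    sixCycleCount G e₁ = a ∧ sixCycleCount G e₂ = b ∧ sixCycleCount G e₃ = c

/-- The graph `Ψ_n = Cay(D_n, {τ_0, τ_1, τ_3})`. -/
def psiGraph (n : ℕ) : SimpleGraph (DihedralGroup n) :=
  cayley ({dihTau 0, dihTau 1, dihTau 3} : Set (DihedralGroup n))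

/-- A finite partial picture of an edge-coloured cubic graph on the vertices `0, 1, …`: the `i`-th
row lists the known neighbours of `i` together with the colours of the edges leading to them. -/
abbrev Sketch := List (List (Bool × ℕ))

/-- The number of hexagons through a 2-path whose two edges have the given colours
(`true` for the exceptional edge at a vertex, `false` for the two others). -/
def hexagonWeight (t : ℕ) (c d : Bool) : ℕ := if c || d then t else 5 - t

/-- The number of edges of a given colour at each vertex. -/
def colourDegree (c : Bool) : ℕ := if c then 1 else 2

namespace Sketch

/-- The list of known coloured neighbours of `i`. -/
def row : Sketch → ℕ → List (Bool × ℕ)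
  | [], _ => []
  | r :: _, 0 => r
  | _ :: s, i + 1 => row s i

/-- Prepend an entry to the `i`-th row. -/
def consAt (x : Bool × ℕ) : Sketch → ℕ → Sketch
  | [], _ => []
  | r :: s, 0 => (x :: r) :: s
  | r :: s, i + 1 => r :: consAt x s i

/-- Join `i` and `j` by an edge of colour `c`. -/
def addEdge (s : Sketch) (c : Bool) (i j : ℕ) : Sketch := consAt (c, i) (consAt (c, j) s i) j

/-- Whether `i` occurs among the given coloured vertices. -/
def hasVertex (i : ℕ) : List (Bool × ℕ) → Bool
  | [] => false
  | e :: l => Nat.beq e.2 i || hasVertex i l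

/-- Whether all three neighbours of `i` are known. -/
def full (s : Sketch) (i : ℕ) : Bool :=
  match s.row i with
  | [_, _, _] => true
  | _ => false

/-- Whether `p` and `q` have a known common neighbour. -/
def linked (s : Sketch) (p q : ℕ) : Bool :=
  (s.row p).any fun x => hasVertex x.2 (s.row q)

/-- Whether `p` has a known neighbour that is not full. -/
def hasRoom (s : Sketch) (p : ℕ) : Bool := (s.row p).any fun x => !(s.full x.2)

/-- Whether `p` and `q` may have a common neighbour. -/
def linkable (s : Sketch) (p q : ℕ) : Bool :=
  s.linked p q || bif s.full p then !(s.full q) && s.hasRoom p else !(s.full q) || s.hasRoom q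

/-- The number of pairs of entries of `l` and `m`, both different from `v`, related by `t`. -/
def countPairs (t : ℕ → ℕ → Bool) (v : ℕ) (l m : List (Bool × ℕ)) : ℕ :=
  l.foldr (fun p n => bif Nat.beq p.2 v then n else m.foldr (fun q n =>
    bif Nat.beq q.2 v then n else bif t p.2 q.2 then Nat.succ n else n) n) 0

/-- Whether the number of hexagons through the 2-path `a, v, b` is certainly not `w`. -/
def violatedPath (s : Sketch) (w v a b : ℕ) : Bool :=
  Nat.blt w (countPairs s.linked v (s.row a) (s.row b)) ||
    (s.full a && s.full b && Nat.blt (countPairs s.linkable v (s.row a) (s.row b)) w)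

/-- Whether some 2-path centred at `v` certainly lies in a wrong number of hexagons. -/
def violatedAt (s : Sketch) (w : Bool → Bool → ℕ) (v : ℕ) : Bool :=
  match s.row v with
  | [x, y] => s.violatedPath (w x.1 y.1) v x.2 y.2
  | [x, y, z] => s.violatedPath (w x.1 y.1) v x.2 y.2 || s.violatedPath (w x.1 z.1) v x.2 z.2 ||
      s.violatedPath (w y.1 z.1) v y.2 z.2
  | _ => false

/-- Whether some 2-path centred at distance two from `i` lies in a wrong number of hexagons. -/
def violatedNear (s : Sketch) (w : Bool → Bool → ℕ) (i : ℕ) : Bool :=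
  (s.row i).any fun x => (s.row x.2).any fun y => !(Nat.beq y.2 i) && s.violatedAt w y.2

/-- The colour of the missing edge of a row with exactly two entries. -/
def missingOfTwo : List (Bool × ℕ) → Option Bool
  | [(true, _), _] => some false
  | [_, (true, _)] => some false
  | [_, _] => some true
  | _ => none

/-- A colour missing from a row with at most one entry. -/
def missingOfFew : List (Bool × ℕ) → Option Bool
  | [] => some false
  | [_] => some false
  | _ => none

/-- A colour and a vertex at which an edge of this colour is missing. -/
def unsaturated (s : Sketch) : Option (Bool × ℕ) :=
  ((List.range s.length).findSome? fun i => (missingOfTwo (s.row i)).map fun c => (c, i)).or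
    ((List.range s.length).findSome? fun i => (missingOfFew (s.row i)).map fun c => (c, i))

/-- Whether all edges of colour `c` at `i` are known. -/
def saturated (s : Sketch) (c : Bool) (i : ℕ) : Bool :=
  Nat.ble (colourDegree c) ((s.row i).countP fun e => e.1 == c)

/-- Whether a new edge of colour `c` may join `i` and `j` without creating a short cycle. -/
def joinable (s : Sketch) (c : Bool) (i j : ℕ) : Bool :=
  !(s.saturated c j || (Nat.beq i j || (s.row i).any fun x => Nat.beq x.2 j ||
    (s.row x.2).any fun y => Nat.beq y.2 j || (s.row y.2).any fun z => Nat.beq z.2 j ||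
      (s.row z.2).any fun t => Nat.beq t.2 j))

/-- Whether `j` is the first vertex other than `i` with its row. -/
def isFirstTwin (s : Sketch) (i j : ℕ) : Bool :=
  (List.range j).all fun k => Nat.beq k i || !(s.row k == s.row j)

/-- The sketches obtained by adding an edge of colour `c` at `i`. -/
def extensions (s : Sketch) (c : Bool) (i : ℕ) : List Sketch :=
  addEdge (s ++ [[]]) c i s.length ::
    ((List.range s.length).filter fun j => s.joinable c i j && s.isFirstTwin i j).map
      fun j => s.addEdge c i j

/-- Whether every way of completing the sketch leads to a sketch satisfying `goal`. -/
def search (w : Bool → Bool → ℕ) (goal : Sketch → Bool) : ℕ → Sketch → Bool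
  | 0, _ => false
  | n + 1, s => goal s ||
    match s.unsaturated with
    | none => false
    | some (c, i) => (s.extensions c i).all fun s' => s'.violatedNear w i || search w goal n s'

/-- The vertices met when walking along edges of colour `false`, starting with `u, v` and
omitting `u`. -/
def walkFrom (s : Sketch) : ℕ → ℕ → ℕ → List ℕ
  | 0, _, _ => []
  | n + 1, u, v => v :: match (s.row v).find? (fun e => !(e.1 || Nat.beq e.2 u)) with
    | none => []
    | some x => walkFrom s n v x.2

/-- Whether the cyclic sequence `l` of vertices exhibits a copy of `Ψ₉`. -/
def isPsi (s : Sketch) (l : List ℕ) : Bool :=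
  Nat.beq l.length 18 && (decide l.Nodup && (l.all (Nat.blt · s.length) &&
    (List.range 9).all fun j => [1, 17, 13].all fun k =>
      hasVertex (l.getD ((2 * j + k) % 18) 0) (s.row (l.getD (2 * j) 0))))

/-- Whether the sketch visibly contains a copy of `Ψ₉`. -/
def containsPsi (s : Sketch) : Bool :=
  Nat.beq s.length 18 && (s.unsaturated.isNone &&
    (s.row 0).any fun x => s.isPsi (s.walkFrom 18 x.2 0))

end Sketch

section Realization

open Sketch

variable {V : Type*} {Γ : SimpleGraph V} {t : ℕ} {col : V → V → Bool} {s : Sketch} {f : ℕ → V}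

/-- The pairs of ends of the 4-paths that prolong the 2-path `a, v, b` at both ends and close up
to a hexagon. -/
def hexagonPairs (Γ : SimpleGraph V) (v a b : V) : Set (V × V) :=
  {z | Γ.Adj a z.1 ∧ z.1 ≠ v ∧ Γ.Adj b z.2 ∧ z.2 ≠ v ∧ ∃ x, Γ.Adj z.1 x ∧ Γ.Adj x z.2}

/-- A cubic graph without cycles of length less than six, with an edge colouring that determines
the number of hexagons through each 2-path. -/
structure IsHexColouring (Γ : SimpleGraph V) (t : ℕ) (col : V → V → Bool) : Prop where
  no_triangle : ∀ {a b c}, Γ.Adj a b → Γ.Adj b c → ¬ Γ.Adj c a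
  eq_of_square : ∀ {a b x y}, Γ.Adj a x → Γ.Adj x b → Γ.Adj a y → Γ.Adj y b → a ≠ b → x = y
  no_pentagon : ∀ {a b c d e}, Γ.Adj a b → Γ.Adj b c → Γ.Adj c d → Γ.Adj d e → ¬ Γ.Adj e a
  col_symm : ∀ u v, col u v = col v u
  card_neighborSet : ∀ v, (Γ.neighborSet v).ncard = 3
  card_colour : ∀ v c, {u | Γ.Adj v u ∧ col v u = c}.ncard = colourDegree c
  card_pairs : ∀ {v a b}, Γ.Adj v a → Γ.Adj v b → a ≠ b →
    (hexagonPairs Γ v a b).ncard = hexagonWeight t (col v a) (col v b)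

/-- The labelling `f` identifies the sketch `s` with a part of the coloured graph. -/
structure Realizes (Γ : SimpleGraph V) (col : V → V → Bool) (s : Sketch) (f : ℕ → V) : Prop where
  inj : ∀ {i j}, i < s.length → j < s.length → f i = f j → i = j
  lt : ∀ {i e}, e ∈ s.row i → e.2 < s.length
  adj : ∀ {i e}, e ∈ s.row i → Γ.Adj (f i) (f e.2)
  colour : ∀ {i e}, e ∈ s.row i → col (f i) (f e.2) = e.1
  symm : ∀ {i e}, e ∈ s.row i → (e.1, i) ∈ s.row e.2
  nodup : ∀ i, (s.row i).Nodup

namespace Sketch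

theorem row_eq_nil {s : Sketch} {i : ℕ} (h : s.length ≤ i) : s.row i = [] := by
  induction s generalizing i with
  | nil => rfl
  | cons r s ih =>
    cases i with
    | zero => simp at h
    | succ i => exact ih (by simpa using h)

theorem lt_of_mem_row {s : Sketch} {i : ℕ} {e : Bool × ℕ} (h : e ∈ s.row i) : i < s.length := by
  by_contra! hi
  simp [row_eq_nil hi] at h

theorem length_consAt (x : Bool × ℕ) (s : Sketch) (i : ℕ) :
    (consAt x s i).length = s.length := by
  induction s generalizing i with
  | nil => rfl
  | cons r s ih => cases i <;> simp [consAt, ih]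

theorem row_consAt {x : Bool × ℕ} {s : Sketch} {i : ℕ} (h : i < s.length) (k : ℕ) :
    (consAt x s i).row k = if k = i then x :: s.row i else s.row k := by
  induction s generalizing i k with
  | nil => simp at h
  | cons r s ih =>
    cases i with
    | zero => cases k <;> simp [consAt, row]
    | succ i =>
      cases k with
      | zero => simp [consAt, row]
      | succ k => simpa [consAt, row] using ih (by simpa using h) k

theorem row_append_nil (s : Sketch) (k : ℕ) : row (s ++ [[]]) k = s.row k := by
  induction s generalizing k with
  | nil => rcases k with _ | _ | k <;> rfl
  | cons r s ih =>
    cases k with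
    | zero => rfl
    | succ k => exact ih k

theorem row_addEdge {s : Sketch} {c : Bool} {i j : ℕ} (hi : i < s.length) (hj : j < s.length)
    (hij : i ≠ j) (k : ℕ) : (s.addEdge c i j).row k =
      if k = j then (c, i) :: s.row j else if k = i then (c, j) :: s.row i else s.row k := by
  rw [addEdge, row_consAt (by rwa [length_consAt]), row_consAt hi, row_consAt hi]
  simp [hij.symm]

theorem length_addEdge (s : Sketch) (c : Bool) (i j : ℕ) :
    (s.addEdge c i j).length = s.length := by
  simp [addEdge, length_consAt]

theorem hasVertex_iff {i : ℕ} {l : List (Bool × ℕ)} : hasVertex i l = true ↔ ∃ e ∈ l, e.2 = i := by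
  induction l with
  | nil => simp [hasVertex]
  | cons e l ih => simp [hasVertex, ih]

theorem full_iff {s : Sketch} {i : ℕ} : s.full i = true ↔ (s.row i).length = 3 := by
  unfold full
  split
  · simp [*]
  · rename_i h
    simp only [Bool.false_eq_true, false_iff]
    intro h3
    obtain ⟨a, b, c, h'⟩ := List.length_eq_three.1 h3
    exact h _ _ _ h'

theorem linked_iff {s : Sketch} {p q : ℕ} :
    s.linked p q = true ↔ ∃ x ∈ s.row p, ∃ y ∈ s.row q, y.2 = x.2 := by
  simp [linked, hasVertex_iff]

theorem hasRoom_iff {s : Sketch} {p : ℕ} :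
    s.hasRoom p = true ↔ ∃ x ∈ s.row p, s.full x.2 = false := by
  simp [hasRoom]

theorem countPairs_eq (t : ℕ → ℕ → Bool) (v : ℕ) (l m : List (Bool × ℕ)) :
    countPairs t v l m = ((l ×ˢ m).filter fun z =>
      z.1.2 ≠ v ∧ z.2.2 ≠ v ∧ t z.1.2 z.2.2 = true).length := by
  have beq (i j : ℕ) : Nat.beq i j = decide (i = j) := by
    rw [Bool.eq_iff_iff]
    simp
  have inner (p : Bool × ℕ) (n : ℕ) : m.foldr (fun q n => bif Nat.beq q.2 v then n else
      bif t p.2 q.2 then Nat.succ n else n) n =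
      (m.filter fun q => q.2 ≠ v ∧ t p.2 q.2 = true).length + n := by
    induction m with
    | nil => simp
    | cons q m ih =>
      rw [List.foldr_cons, ih]
      by_cases h : q.2 = v <;> by_cases h' : t p.2 q.2 = true <;>
        simp [beq, h, h', Nat.add_right_comm]
  unfold countPairs
  simp only [inner]
  induction l with
  | nil => simp
  | cons p l ih =>
    rw [List.foldr_cons, ih, List.product_cons, List.filter_append, List.length_append,
      List.filter_map, List.length_map]
    by_cases h : p.2 = v
    · simp [h, Function.comp_def]
    · simp [beq, h, Function.comp_def]

theorem lt_of_unsaturated {s : Sketch} {c : Bool} {i : ℕ} (h : s.unsaturated = some (c, i)) :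
    i < s.length ∧ (s.row i).countP (fun e => e.1 == c) < colourDegree c := by
  have h2 {l : List (Bool × ℕ)} {c : Bool} (h : missingOfTwo l = some c) :
      l.countP (fun e => e.1 == c) < colourDegree c := by
    unfold missingOfTwo at h
    split at h <;> (simp_all [colourDegree]; try grind)
  have h1 {l : List (Bool × ℕ)} {c : Bool} (h : missingOfFew l = some c) :
      l.countP (fun e => e.1 == c) < colourDegree c := by
    unfold missingOfFew at h
    split at h <;> (simp_all [colourDegree]; try grind)
  rw [unsaturated, Option.or_eq_some_iff] at h
  rcases h with h | ⟨-, h⟩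
  all_goals
    obtain ⟨j, hj, h⟩ := List.exists_of_findSome?_eq_some h
    simp only [Option.map_eq_some_iff, Prod.mk.injEq, List.mem_range] at h hj
    obtain ⟨c', hc, rfl, rfl⟩ := h
  · exact ⟨hj, h2 hc⟩
  · exact ⟨hj, h1 hc⟩

end Sketch

theorem Set.ncard_setOf_mem_list {α : Type*} {L : List α} (hL : L.Nodup) :
    {a | a ∈ L}.ncard = L.length := by
  classical
  rw [← List.toFinset_card_of_nodup hL, ← Set.ncard_coe_finset]
  simp

theorem Set.length_le_ncard {α β : Type*} {L : List α} (hL : L.Nodup) {g : α → β} {S : Set β}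
    (hS : S.Finite) (hg : ∀ a ∈ L, ∀ b ∈ L, g a = g b → a = b) (hm : ∀ a ∈ L, g a ∈ S) :
    L.length ≤ S.ncard := by
  have hinj : Set.InjOn g {a | a ∈ L} := fun a ha b hb => hg a ha b hb
  rw [← Set.ncard_setOf_mem_list hL, ← hinj.ncard_image]
  exact Set.ncard_le_ncard (Set.image_subset_iff.2 hm) hS

theorem Set.exists_of_ncard_le_length {α β : Type*} {L : List α} (hL : L.Nodup) {g : α → β}
    {S : Set β} (hS : S.Finite) (hg : ∀ a ∈ L, ∀ b ∈ L, g a = g b → a = b)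
    (hm : ∀ a ∈ L, g a ∈ S) (h : S.ncard ≤ L.length) {x : β} (hx : x ∈ S) :
    ∃ a ∈ L, g a = x := by
  have hinj : Set.InjOn g {a | a ∈ L} := fun a ha b hb => hg a ha b hb
  rw [← Set.ncard_setOf_mem_list hL, ← hinj.ncard_image] at h
  rw [← Set.eq_of_subset_of_ncard_le (Set.image_subset_iff.2 hm) h hS] at hx
  exact hx

theorem Set.ncard_le_length {α β : Type*} {L : List α} (hL : L.Nodup) {g : α → β} {S : Set β}
    (h : ∀ x ∈ S, ∃ a ∈ L, g a = x) : S.ncard ≤ L.length := by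
  rw [← Set.ncard_setOf_mem_list hL]
  exact (Set.ncard_le_ncard (t := g '' {a | a ∈ L}) h ((List.finite_toSet L).image g)).trans
    (Set.ncard_image_le (List.finite_toSet L))

namespace Realizes

theorem eq_of_mem (h : Realizes Γ col s f) {i : ℕ} {e e' : Bool × ℕ} (he : e ∈ s.row i)
    (he' : e' ∈ s.row i) (h2 : f e.2 = f e'.2) : e = e' :=
  Prod.ext ((h.colour he).symm.trans (h2 ▸ h.colour he')) (h.inj (h.lt he) (h.lt he') h2)

theorem mem_row_of_colour (h : Realizes Γ col s f) {i j : ℕ} {c : Bool} {e : Bool × ℕ}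
    (he : e ∈ s.row i) (hj : e.2 = j) (hc : col (f i) (f j) = c) : (c, j) ∈ s.row i := by
  subst hj
  rw [← hc, h.colour he]
  exact he

theorem addEdge (h : Realizes Γ col s f) {c : Bool} {i j : ℕ} (hi : i < s.length)
    (hj : j < s.length) (hadj : Γ.Adj (f i) (f j)) (hc : col (f i) (f j) = c)
    (hc' : col (f j) (f i) = c) (hnew : (c, j) ∉ s.row i) : Realizes Γ col (s.addEdge c i j) f := by
  have hij : i ≠ j := fun e => hadj.ne (congrArg f e)
  have hrow := row_addEdge (c := c) hi hj hij
  have hmem {k : ℕ} {e : Bool × ℕ} : e ∈ (s.addEdge c i j).row k ↔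
      e ∈ s.row k ∨ (k = i ∧ e = (c, j)) ∨ (k = j ∧ e = (c, i)) := by
    rw [hrow]
    split_ifs with h1 h2
    · subst h1
      simp [hij.symm, or_comm]
    · subst h2
      simp [hij, or_comm]
    · simp [h1, h2]
  have hnew' : (c, i) ∉ s.row j := fun hm => hnew (h.symm hm)
  constructor
  · intro k l hk hl
    rw [length_addEdge] at hk hl
    exact h.inj hk hl
  · intro k e he
    rw [length_addEdge]
    rcases hmem.1 he with he | ⟨-, rfl⟩ | ⟨-, rfl⟩
    exacts [h.lt he, hj, hi]
  · intro k e he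
    rcases hmem.1 he with he | ⟨rfl, rfl⟩ | ⟨rfl, rfl⟩
    exacts [h.adj he, hadj, hadj.symm]
  · intro k e he
    rcases hmem.1 he with he | ⟨rfl, rfl⟩ | ⟨rfl, rfl⟩
    exacts [h.colour he, hc, hc']
  · intro k e he
    rcases hmem.1 he with he | ⟨rfl, rfl⟩ | ⟨rfl, rfl⟩
    exacts [hmem.2 (.inl (h.symm he)), hmem.2 (by simp), hmem.2 (by simp)]
  · intro k
    rw [hrow]
    split_ifs
    exacts [(h.nodup j).cons hnew', (h.nodup i).cons hnew, h.nodup k]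

theorem append_nil (h : Realizes Γ col s f) {x : V} (hx : ∀ k < s.length, f k ≠ x) :
    Realizes Γ col (s ++ [[]]) (Function.update f s.length x) := by
  have hf {k : ℕ} (hk : k < s.length) : Function.update f s.length x k = f k :=
    Function.update_of_ne hk.ne _ _
  constructor
  · intro i j hi hj hij
    rw [List.length_append, List.length_singleton, Nat.lt_succ_iff_lt_or_eq] at hi hj
    rcases hi with hi | rfl <;> rcases hj with hj | rfl
    · rw [hf hi, hf hj] at hij
      exact h.inj hi hj hij
    · rw [hf hi, Function.update_self] at hij
      exact absurd hij (hx i hi)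
    · rw [hf hj, Function.update_self] at hij
      exact absurd hij.symm (hx j hj)
    · rfl
  all_goals intro i
  all_goals rw [row_append_nil]
  all_goals try intro e he
  · simpa using (h.lt he).trans (Nat.lt_succ_self _)
  · rw [hf (lt_of_mem_row he), hf (h.lt he)]
    exact h.adj he
  · rw [hf (lt_of_mem_row he), hf (h.lt he)]
    exact h.colour he
  · rw [row_append_nil]
    exact h.symm he
  · exact h.nodup i

theorem swap (h : Realizes Γ col s f) {j k : ℕ} (hj : j < s.length) (hk : k < s.length)
    (hrow : s.row j = s.row k) : Realizes Γ col s (f ∘ Equiv.swap j k) := by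
  have hlt {i : ℕ} (hi : i < s.length) : Equiv.swap j k i < s.length := by
    rw [Equiv.swap_apply_def]
    split_ifs <;> assumption
  have hmem {i : ℕ} {e : Bool × ℕ} (he : e ∈ s.row i) :
      (e.1, Equiv.swap j k e.2) ∈ s.row (Equiv.swap j k i) := by
    have key {i : ℕ} : s.row (Equiv.swap j k i) = s.row i := by
      rw [Equiv.swap_apply_def]
      split_ifs with h1 h2
      exacts [h1 ▸ hrow.symm, h2 ▸ hrow, rfl]
    rw [key]
    have := h.symm he
    rw [← key] at this
    exact h.symm this
  constructor
  · intro a b ha hb hab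
    exact (Equiv.swap j k).injective (h.inj (hlt ha) (hlt hb) hab)
  · exact h.lt
  · exact fun he => h.adj (hmem he)
  · exact fun he => h.colour (hmem he)
  · exact h.symm
  · exact h.nodup

theorem exists_adj_of_lt (hΓ : IsHexColouring Γ t col) (h : Realizes Γ col s f) {c : Bool} {i : ℕ}
    (hs : (s.row i).countP (fun e => e.1 == c) < colourDegree c) :
    ∃ x, Γ.Adj (f i) x ∧ col (f i) x = c ∧ ∀ j, f j = x → (c, j) ∉ s.row i := by
  by_contra! hx
  rw [← hΓ.card_colour (f i), List.countP_eq_length_filter] at hs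
  refine hs.not_ge (Set.ncard_le_length (g := fun e => f e.2) ((h.nodup i).filter _) ?_)
  rintro x ⟨hx1, hx2⟩
  obtain ⟨j, rfl, hj⟩ := hx x hx1 hx2
  exact ⟨(c, j), by simp [hj], rfl⟩

theorem exists_isFirstTwin (h : Realizes Γ col s f) {i j : ℕ} (hij : i ≠ j) (hj : j < s.length) :
    ∃ k f', Realizes Γ col s f' ∧ k < s.length ∧ f' k = f j ∧ f' i = f i ∧
      s.row k = s.row j ∧ s.isFirstTwin i k = true := by
  induction j using Nat.strong_induction_on generalizing f with
  | _ j ih =>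
    by_cases hf : s.isFirstTwin i j = true
    · exact ⟨j, f, h, hj, rfl, rfl, rfl, hf⟩
    simp only [isFirstTwin, List.all_eq_true, List.mem_range, Bool.or_eq_true, Nat.beq_eq,
      Bool.not_eq_true', beq_eq_false_iff_ne, not_forall, not_or, not_not] at hf
    obtain ⟨k, hkj, hki, hrow⟩ := hf
    obtain ⟨k', f', h', hk', hf'⟩ := ih k hkj (h.swap (hkj.trans hj) hj hrow) (Ne.symm hki)
      (hkj.trans hj)
    refine ⟨k', f', h', hk', hf'.1.trans (by simp), hf'.2.1.trans ?_,
      hf'.2.2.1.trans hrow, hf'.2.2.2⟩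
    simp [Equiv.swap_apply_of_ne_of_ne (Ne.symm hki) hij]

theorem nil (col : V → V → Bool) (v : V) : Realizes Γ col [[]] fun _ => v := by
  have hrow (i : ℕ) : row [[]] i = [] := row_append_nil [] i
  constructor <;> simp [hrow]

variable [Finite V] (hΓ : IsHexColouring Γ t col)
include hΓ

theorem mem_row_of_saturated (h : Realizes Γ col s f) {c : Bool} {i : ℕ}
    (hs : s.saturated c i = true) {x : V} (hx : Γ.Adj (f i) x) (hc : col (f i) x = c) :
    ∃ j, (c, j) ∈ s.row i ∧ f j = x := by
  have hs' : {u | Γ.Adj (f i) u ∧ col (f i) u = c}.ncard ≤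
      ((s.row i).filter fun e => e.1 == c).length := by
    rw [hΓ.card_colour, ← List.countP_eq_length_filter]
    exact Nat.le_of_ble_eq_true hs
  have hmem {e : Bool × ℕ} : e ∈ (s.row i).filter (fun e => e.1 == c) ↔ e ∈ s.row i ∧ e.1 = c := by
    rw [List.mem_filter, beq_iff_eq]
  obtain ⟨e, he, rfl⟩ := Set.exists_of_ncard_le_length (g := fun e => f e.2)
    (S := {u | Γ.Adj (f i) u ∧ col (f i) u = c}) ((h.nodup i).filter _) (Set.toFinite _)
    (fun a ha b hb => h.eq_of_mem (hmem.1 ha).1 (hmem.1 hb).1)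
    (fun a ha => ⟨h.adj (hmem.1 ha).1, (h.colour (hmem.1 ha).1).trans (hmem.1 ha).2⟩) hs' ⟨hx, hc⟩
  exact ⟨e.2, (hmem.1 he).2 ▸ (hmem.1 he).1, rfl⟩

theorem mem_row_of_full (h : Realizes Γ col s f) {i : ℕ} (hs : s.full i = true) {x : V}
    (hx : Γ.Adj (f i) x) : ∃ e ∈ s.row i, f e.2 = x :=
  Set.exists_of_ncard_le_length (g := fun e => f e.2) (S := Γ.neighborSet (f i)) (h.nodup i)
    (Set.toFinite _) (fun _ ha _ hb => h.eq_of_mem ha hb) (fun _ ha => h.adj ha)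
    (by rw [hΓ.card_neighborSet, full_iff.1 hs]) hx

theorem joinable (h : Realizes Γ col s f) {c : Bool} {i j : ℕ} (hadj : Γ.Adj (f i) (f j))
    (hc : col (f i) (f j) = c) (hnew : (c, j) ∉ s.row i) (hj : j < s.length) (hi : i < s.length) :
    s.joinable c i j = true := by
  have hne {e : Bool × ℕ} (he : e ∈ s.row i) : e.2 ≠ j :=
    fun hej => hnew (h.mem_row_of_colour he hej hc)
  rw [Sketch.joinable, Bool.not_eq_true', Bool.eq_false_iff]
  intro hs
  simp only [Bool.or_eq_true, List.any_eq_true, Nat.beq_eq] at hs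
  obtain hs | rfl | ⟨x, hx, hs | ⟨y, hy, hs | ⟨z, hz, hs | ⟨w, hw, hs⟩⟩⟩⟩ := hs
  · obtain ⟨k, hk, hki⟩ := h.mem_row_of_saturated hΓ hs hadj.symm ((hΓ.col_symm _ _).trans hc)
    obtain rfl := h.inj (h.lt hk) hi hki
    exact hnew (h.symm hk)
  · exact hadj.ne rfl
  · exact hne hx hs
  · subst hs
    exact hΓ.no_triangle (h.adj hx) (h.adj hy) hadj.symm
  · subst hs
    have hyi : f i ≠ f y.2 := fun hiy => by
      have := h.inj hi (h.lt hy) hiy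
      rw [← this] at hz
      exact hne hz rfl
    exact hne hx (h.inj (h.lt hx) hj (hΓ.eq_of_square (h.adj hx) (h.adj hy) hadj
      (h.adj hz).symm hyi))
  · subst hs
    exact hΓ.no_pentagon (h.adj hx) (h.adj hy) (h.adj hz) (h.adj hw) hadj.symm

theorem not_adj_adj_of_full (h : Realizes Γ col s f) {p q : ℕ} (hq : q < s.length)
    (hp : s.full p = true) (hpq : s.linked p q = false)
    (hor : s.full q = true ∨ s.hasRoom p = false) {x : V} (hpx : Γ.Adj (f p) x) :
    ¬ Γ.Adj (f q) x := by
  intro hqx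
  refine Bool.eq_false_iff.1 hpq (linked_iff.2 ?_)
  obtain ⟨e, he, rfl⟩ := h.mem_row_of_full hΓ hp hpx
  rcases hor with hor | hor
  · obtain ⟨d, hd, hde⟩ := h.mem_row_of_full hΓ hor hqx
    exact ⟨e, he, d, hd, h.inj (h.lt hd) (h.lt he) hde⟩
  · have hfull : s.full e.2 = true := by
      by_contra hne
      exact Bool.eq_false_iff.1 hor (hasRoom_iff.2 ⟨e, he, by simpa using hne⟩)
    obtain ⟨d, hd, hde⟩ := h.mem_row_of_full hΓ hfull hqx.symm
    obtain rfl := h.inj (h.lt hd) hq hde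
    exact ⟨e, he, _, h.symm hd, rfl⟩

theorem linkable (h : Realizes Γ col s f) {p q : ℕ} (hp : p < s.length) (hq : q < s.length)
    {x : V} (hpx : Γ.Adj (f p) x) (hqx : Γ.Adj (f q) x) : s.linkable p q = true := by
  by_contra hpq
  rw [Bool.not_eq_true, Sketch.linkable, Bool.or_eq_false_iff] at hpq
  obtain ⟨hl, hpq⟩ := hpq
  cases hfp : s.full p
  · have hl' : s.linked q p = false := by
      rw [Bool.eq_false_iff] at hl ⊢
      intro hl'
      obtain ⟨x, hx, y, hy, hxy⟩ := linked_iff.1 hl'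
      exact hl (linked_iff.2 ⟨y, hy, x, hx, hxy.symm⟩)
    simp only [hfp, cond_false, Bool.or_eq_false_iff, Bool.not_eq_false'] at hpq
    exact h.not_adj_adj_of_full hΓ hp hpq.1 hl' (.inr hpq.2) hqx hpx
  · simp only [hfp, cond_true, Bool.and_eq_false_iff, Bool.not_eq_false'] at hpq
    exact h.not_adj_adj_of_full hΓ hq hfp hl hpq hpx hqx

theorem violatedPath (h : Realizes Γ col s f) {v : ℕ} {a b : Bool × ℕ} (ha : a ∈ s.row v)
    (hb : b ∈ s.row v) (hab : a ≠ b) :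
    s.violatedPath (hexagonWeight t a.1 b.1) v a.2 b.2 = false := by
  have hv := lt_of_mem_row ha
  have hw := hΓ.card_pairs (h.adj ha) (h.adj hb) fun e => hab (h.eq_of_mem ha hb e)
  rw [h.colour ha, h.colour hb] at hw
  have hnd (u : ℕ → ℕ → Bool) : ((s.row a.2 ×ˢ s.row b.2).filter fun z =>
      z.1.2 ≠ v ∧ z.2.2 ≠ v ∧ u z.1.2 z.2.2 = true).Nodup :=
    ((h.nodup _).product (h.nodup _)).filter _
  rw [← hw, Sketch.violatedPath, Bool.or_eq_false_iff, countPairs_eq, countPairs_eq]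
  constructor
  · rw [← Bool.not_eq_true, Nat.blt_eq, not_lt]
    refine Set.length_le_ncard (g := fun z => (f z.1.2, f z.2.2)) (hnd _) (Set.toFinite _) ?_ ?_
    · rintro ⟨y, y'⟩ hy ⟨z, z'⟩ hz hyz
      simp only [List.mem_filter, List.mem_product, Prod.mk.injEq] at hy hz hyz ⊢
      exact ⟨h.eq_of_mem hy.1.1 hz.1.1 hyz.1, h.eq_of_mem hy.1.2 hz.1.2 hyz.2⟩
    · rintro ⟨y, y'⟩ hy
      simp only [List.mem_filter, List.mem_product, decide_eq_true_eq, linked_iff] at hy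
      obtain ⟨⟨hy, hy'⟩, hyv, hyv', x, hx, x', hx', hxx⟩ := hy
      refine ⟨h.adj hy, fun e => hyv (h.inj (h.lt hy) hv e), h.adj hy',
        fun e => hyv' (h.inj (h.lt hy') hv e), f x.2, h.adj hx, ?_⟩
      rw [← hxx]
      exact (h.adj hx').symm
  · rw [Bool.and_eq_false_iff, Bool.and_eq_false_iff, or_iff_not_imp_left]
    intro hfull
    simp only [not_or, Bool.not_eq_false] at hfull
    rw [← Bool.not_eq_true, Nat.blt_eq, not_lt]
    refine Set.ncard_le_length (g := fun z => (f z.1.2, f z.2.2)) (hnd _) ?_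
    rintro ⟨p, q⟩ ⟨hp, hpv, hq, hqv, x, hpx, hqx⟩
    obtain ⟨y, hy, rfl⟩ := h.mem_row_of_full hΓ hfull.1 hp
    obtain ⟨z, hz, rfl⟩ := h.mem_row_of_full hΓ hfull.2 hq
    refine ⟨(y, z), ?_, rfl⟩
    simp only [List.mem_filter, List.mem_product, decide_eq_true_eq]
    exact ⟨⟨hy, hz⟩, fun e => hpv (congrArg f e), fun e => hqv (congrArg f e),
      h.linkable hΓ (h.lt hy) (h.lt hz) hpx hqx.symm⟩

theorem violatedAt (h : Realizes Γ col s f) (v : ℕ) :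
    s.violatedAt (hexagonWeight t) v = false := by
  have hnd := h.nodup v
  have key {a b : Bool × ℕ} : a ∈ s.row v → b ∈ s.row v → a ≠ b →
    s.violatedPath (hexagonWeight t a.1 b.1) v a.2 b.2 = false := h.violatedPath hΓ
  unfold Sketch.violatedAt
  split
  · rename_i x y hrow
    rw [hrow] at key hnd
    simp only [List.nodup_cons, List.mem_cons, List.not_mem_nil, or_false] at hnd
    exact key (by simp) (by simp) hnd.1
  · rename_i x y z hrow
    rw [hrow] at key hnd
    simp only [List.nodup_cons, List.mem_cons, List.not_mem_nil, or_false, not_or] at hnd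
    rw [key (by simp) (by simp) hnd.1.1, key (by simp) (by simp) hnd.1.2,
      key (by simp) (by simp) hnd.2.1]
    rfl
  · rfl

theorem violatedNear (h : Realizes Γ col s f) (i : ℕ) :
    s.violatedNear (hexagonWeight t) i = false := by
  simp [Sketch.violatedNear, h.violatedAt hΓ]

theorem exists_extension (h : Realizes Γ col s f) {c : Bool} {i : ℕ}
    (hs : s.unsaturated = some (c, i)) :
    ∃ s' ∈ s.extensions c i, ∃ f', Realizes Γ col s' f' := by
  obtain ⟨hi, hcount⟩ := lt_of_unsaturated hs
  obtain ⟨x, hadj, hc, hnew⟩ := h.exists_adj_of_lt hΓ hcount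
  have hc' := (hΓ.col_symm _ _).trans hc
  by_cases hx : ∃ j < s.length, f j = x
  · obtain ⟨j, hj, rfl⟩ := hx
    have hij : i ≠ j := fun e => hadj.ne (congrArg f e)
    obtain ⟨k, f', h', hk, hkj, hfi, hrow, hfirst⟩ := h.exists_isFirstTwin hij hj
    rw [← hkj, ← hfi] at hadj hc hc'
    have hk' : (c, k) ∉ s.row i := fun hm => by
      have := h.symm hm
      rw [hrow] at this
      exact hnew j rfl (h.symm this)
    refine ⟨_, List.mem_cons_of_mem _
      (List.mem_map_of_mem (List.mem_filter.2 ⟨List.mem_range.2 hk, ?_⟩)),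
      f', h'.addEdge hi hk hadj hc hc' hk'⟩
    rw [h'.joinable hΓ hadj hc hk' hk hi, hfirst]
    rfl
  · push Not at hx
    have h' := h.append_nil hx
    refine ⟨_, List.mem_cons_self, _, h'.addEdge ?_ ?_ ?_ ?_ ?_ ?_⟩
    all_goals try rw [Function.update_of_ne hi.ne, Function.update_self]
    · simpa using hi.trans (Nat.lt_succ_self _)
    · simp
    · exact hadj
    · exact hc
    · exact hc'
    · rw [row_append_nil]
      exact fun hm => (h.lt hm).ne rfl

theorem exists_goal_of_search (h : Realizes Γ col s f) {goal : Sketch → Bool} {n : ℕ}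
    (hs : search (hexagonWeight t) goal n s = true) :
    ∃ s' f', Realizes Γ col s' f' ∧ goal s' = true := by
  induction n generalizing s f with
  | zero => simp [search] at hs
  | succ n ih =>
    rw [search, Bool.or_eq_true] at hs
    rcases hs with hs | hs
    · exact ⟨s, f, h, hs⟩
    · split at hs
      · simp at hs
      · rename_i c i hu
        obtain ⟨s', hs', f', h'⟩ := h.exists_extension hΓ hu
        have := List.all_eq_true.1 hs s' hs'
        rw [h'.violatedNear hΓ, Bool.false_or] at this
        exact ih h' this

end Realizes

/-- The position of an element of the dihedral group on a Hamiltonian cycle of `Ψ₉`. -/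
def psiPosition : DihedralGroup 9 → ℕ
  | .r i => 2 * i.val
  | .sr i => 2 * i.val + 1

theorem psiPosition_lt (x : DihedralGroup 9) : psiPosition x < 18 := by
  rcases x with i | i
  all_goals
    have := ZMod.val_lt i
    simp only [psiPosition]
    omega

theorem psiPosition_injective : Function.Injective psiPosition := by
  rintro (i | i) (j | j) h
  all_goals simp only [psiPosition] at h
  · rw [ZMod.val_injective 9 (by omega : i.val = j.val)]
  · omega
  · omega
  · rw [ZMod.val_injective 9 (by omega : i.val = j.val)]

theorem psiGraph_adj_r_sr {n : ℕ} {i k : ZMod n} :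
    (psiGraph n).Adj (.r i) (.sr k) ↔ k = i ∨ k = i - 1 ∨ k = i - 3 := by
  have h1 : dihTau (n := n) 1 = .sr (-1) := by simp [dihTau]
  have h3 : dihTau (n := n) 3 = .sr (-3) := by simp [dihTau]
  have h0 : dihTau (n := n) 0 = .sr 0 := by simp [dihTau]
  simp only [psiGraph, cayley, SimpleGraph.fromRel_adj, h0, h1, h3, Set.mem_insert_iff,
    Set.mem_singleton_iff, DihedralGroup.inv_sr, DihedralGroup.inv_r, DihedralGroup.r_mul_sr,
    DihedralGroup.sr_mul_r, DihedralGroup.sr.injEq, sub_eq_zero]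
  grind

theorem psiGraph_not_adj_r_r {n : ℕ} {i k : ZMod n} : ¬ (psiGraph n).Adj (.r i) (.r k) := by
  simp [psiGraph, cayley, dihTau]

theorem psiGraph_not_adj_sr_sr {n : ℕ} {i k : ZMod n} : ¬ (psiGraph n).Adj (.sr i) (.sr k) := by
  simp [psiGraph, cayley, dihTau]

theorem psiPosition_sr_sub_one :
    ∀ i : ZMod 9, psiPosition (.sr (i - 1)) = (2 * i.val + 17) % 18 := by
  decide

theorem psiPosition_sr_sub_three :
    ∀ i : ZMod 9, psiPosition (.sr (i - 3)) = (2 * i.val + 13) % 18 := by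
  decide

theorem Realizes.exists_psiGraph_hom (h : Realizes Γ col s f) (hs : s.containsPsi = true) :
    ∃ φ : DihedralGroup 9 → V, Function.Injective φ ∧
      ∀ x y, (psiGraph 9).Adj x y → Γ.Adj (φ x) (φ y) := by
  simp only [containsPsi, Bool.and_eq_true, List.any_eq_true] at hs
  obtain ⟨-, -, e, -, hs⟩ := hs
  generalize s.walkFrom 18 e.2 0 = l at hs
  simp only [isPsi, Bool.and_eq_true, Nat.beq_eq, decide_eq_true_eq, List.all_eq_true,
    Nat.blt_eq, List.mem_range, hasVertex_iff] at hs
  obtain ⟨hl, hnd, hlt, hadj⟩ := hs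
  have hget (x : DihedralGroup 9) : l.getD (psiPosition x) 0 =
      l[psiPosition x]'(by rw [hl]; exact psiPosition_lt x) :=
    List.getD_eq_getElem _ _ _
  have key (i : ZMod 9) (k : ZMod 9) (hik : (psiGraph 9).Adj (.r i) (.sr k)) :
      Γ.Adj (f (l.getD (psiPosition (.r i)) 0)) (f (l.getD (psiPosition (.sr k)) 0)) := by
    suffices ∃ d ∈ [1, 17, 13], psiPosition (.sr k) = (2 * i.val + d) % 18 by
      obtain ⟨d, hd, hk⟩ := this
      obtain ⟨e, he, hek⟩ := hadj i.val (ZMod.val_lt i) d hd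
      rw [hk, ← hek]
      exact h.adj he
    rcases psiGraph_adj_r_sr.1 hik with rfl | rfl | rfl
    · refine ⟨1, by simp, ?_⟩
      have := psiPosition_lt (.sr k)
      rw [psiPosition] at this ⊢
      exact (Nat.mod_eq_of_lt this).symm
    · exact ⟨17, by simp, psiPosition_sr_sub_one i⟩
    · exact ⟨13, by simp, psiPosition_sr_sub_three i⟩
  refine ⟨fun x => f (l.getD (psiPosition x) 0), ?_, ?_⟩
  · intro x y hxy
    simp only [hget] at hxy
    exact psiPosition_injective ((hnd.getElem_inj_iff).1
      (h.inj (hlt _ (List.getElem_mem _)) (hlt _ (List.getElem_mem _)) hxy))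
  · rintro (i | i) (k | k) hik
    · exact absurd hik psiGraph_not_adj_r_r
    · exact key i k hik
    · exact (key k i hik.symm).symm
    · exact absurd hik psiGraph_not_adj_sr_sr

end Realization

theorem three_le_ncard_neighborSet_psiGraph (x : DihedralGroup 9) :
    3 ≤ ((psiGraph 9).neighborSet x).ncard := by
  have h3 {a b c : DihedralGroup 9} (ha : (psiGraph 9).Adj x a) (hb : (psiGraph 9).Adj x b)
      (hc : (psiGraph 9).Adj x c) (hab : a ≠ b) (hac : a ≠ c) (hbc : b ≠ c) :
      3 ≤ ((psiGraph 9).neighborSet x).ncard := by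
    rw [← Set.ncard_eq_three.2 ⟨a, b, c, hab, hac, hbc, rfl⟩]
    refine Set.ncard_le_ncard ?_ (Set.toFinite _)
    rintro y (rfl | rfl | rfl) <;> assumption
  rcases x with i | i
  · obtain ⟨h1, h2, h3'⟩ : i ≠ i - 1 ∧ i ≠ i - 3 ∧ i - 1 ≠ i - 3 := by
      clear h3
      revert i
      decide
    apply h3 (a := .sr i) (b := .sr (i - 1)) (c := .sr (i - 3)) <;> simp [psiGraph_adj_r_sr, *]
  · obtain ⟨h1, h2, h3'⟩ : i ≠ i + 1 ∧ i ≠ i + 3 ∧ i + 1 ≠ i + 3 := by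
      clear h3
      revert i
      decide
    apply h3 (a := .r i) (b := .r (i + 1)) (c := .r (i + 3)) <;>
      simp [SimpleGraph.adj_comm _ (DihedralGroup.sr i), psiGraph_adj_r_sr, *]

theorem nonempty_iso_of_injective_hom {V W : Type*} [Finite V] {Γ : SimpleGraph V}
    {Δ : SimpleGraph W} [Nonempty W] {φ : W → V} (hφ : Function.Injective φ)
    (hadj : ∀ x y, Δ.Adj x y → Γ.Adj (φ x) (φ y)) (hconn : Γ.Connected)
    (hcard : ∀ x, (Γ.neighborSet (φ x)).ncard ≤ (Δ.neighborSet x).ncard) :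
    Nonempty (Γ ≃g Δ) := by
  have himage (x : W) : φ '' Δ.neighborSet x = Γ.neighborSet (φ x) := by
    refine Set.eq_of_subset_of_ncard_le (Set.image_subset_iff.2 fun y hy => hadj x y hy) ?_
      (Set.toFinite _)
    rw [Set.ncard_image_of_injective _ hφ]
    exact hcard x
  have hmem {x : W} {v : V} (hv : Γ.Adj (φ x) v) : ∃ y, Δ.Adj x y ∧ φ y = v := by
    rw [← SimpleGraph.mem_neighborSet, ← himage] at hv
    exact hv
  have hsurj : Function.Surjective φ := by
    obtain ⟨x⟩ := ‹Nonempty W›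
    intro v
    induction SimpleGraph.reachable_iff_reflTransGen _ _ |>.1 (hconn.preconnected (φ x) v) with
    | refl => exact ⟨x, rfl⟩
    | tail _ huv ih =>
      obtain ⟨y, rfl⟩ := ih
      obtain ⟨z, -, hz⟩ := hmem huv
      exact ⟨z, hz⟩
  refine ⟨RelIso.symm ⟨Equiv.ofBijective φ ⟨hφ, hsurj⟩, ?_⟩⟩
  intro x y
  refine ⟨fun h => ?_, hadj x y⟩
  obtain ⟨z, hz, hzy⟩ := hmem h
  rwa [← hφ hzy]

set_option maxRecDepth 100000 in
set_option maxHeartbeats 0 in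
theorem Sketch.search_two : Sketch.search (hexagonWeight 2) Sketch.containsPsi 40 [[]] = true := by
  decide +kernel

set_option maxRecDepth 100000 in
set_option maxHeartbeats 0 in
theorem Sketch.search_one : Sketch.search (hexagonWeight 1) (fun _ => false) 40 [[]] = true := by
  decide +kernel

set_option maxRecDepth 100000 in
set_option maxHeartbeats 0 in
theorem Sketch.search_zero : Sketch.search (hexagonWeight 0) (fun _ => false) 40 [[]] = true := by
  decide +kernel

theorem IsHexColouring.eq_two_and_nonempty_iso {V : Type*} [Finite V] {Γ : SimpleGraph V} {t : ℕ}
    {col : V → V → Bool} (hΓ : IsHexColouring Γ t col) (ht : t ≤ 2) (hconn : Γ.Connected) :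
    t = 2 ∧ Nonempty (Γ ≃g psiGraph 9) := by
  obtain ⟨v⟩ := hconn.nonempty
  have h0 : Realizes Γ col [[]] fun _ => v := Realizes.nil col v
  interval_cases t
  · obtain ⟨s, f, -, h⟩ := h0.exists_goal_of_search hΓ Sketch.search_zero
    simp at h
  · obtain ⟨s, f, -, h⟩ := h0.exists_goal_of_search hΓ Sketch.search_one
    simp at h
  · obtain ⟨s, f, hf, h⟩ := h0.exists_goal_of_search hΓ Sketch.search_two
    obtain ⟨φ, hφ, hadj⟩ := hf.exists_psiGraph_hom h
    refine ⟨rfl, nonempty_iso_of_injective_hom hφ hadj hconn fun x => ?_⟩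
    rw [hΓ.card_neighborSet]
    exact three_le_ncard_neighborSet_psiGraph x

namespace SimpleGraph

variable {V : Type*} {Γ : SimpleGraph V}

theorem not_adj_of_three_lt_girth (h : 3 < Γ.girth) {a b c : V} (hab : Γ.Adj a b)
    (hbc : Γ.Adj b c) : ¬ Γ.Adj c a := by
  intro hca
  refine h.not_ge (girth_le_length (w := .cons hab (.cons hbc (.cons hca .nil))) ?_)
  simp [Walk.cons_isCycle_iff, hab.ne, hab.ne', hbc.ne, hca.ne, hca.ne']

theorem eq_of_adj_of_four_lt_girth (h : 4 < Γ.girth) {a b x y : V} (hax : Γ.Adj a x)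
    (hxb : Γ.Adj x b) (hay : Γ.Adj a y) (hyb : Γ.Adj y b) (hab : a ≠ b) : x = y := by
  by_contra hxy
  refine h.not_ge (girth_le_length
    (w := .cons hax (.cons hxb (.cons hyb.symm (.cons hay.symm .nil)))) ?_)
  simp [Walk.cons_isCycle_iff, hax.ne, hax.ne', hxb.ne, hay.ne, hay.ne', hyb.ne', hab, hab.symm,
    hxy]

theorem not_adj_of_five_lt_girth (h : 5 < Γ.girth) {a b c d e : V} (hab : Γ.Adj a b)
    (hbc : Γ.Adj b c) (hcd : Γ.Adj c d) (hde : Γ.Adj d e) : ¬ Γ.Adj e a := by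
  intro hea
  have h3 {a b c : V} : Γ.Adj a b → Γ.Adj b c → ¬ Γ.Adj c a :=
    not_adj_of_three_lt_girth (by omega)
  have hac : a ≠ c := by
    rintro rfl
    exact h3 hcd hde hea
  have hbd : b ≠ d := by
    rintro rfl
    exact h3 hde hea hab
  have hce : c ≠ e := by
    rintro rfl
    exact h3 hea hab hbc
  have hda : d ≠ a := by
    rintro rfl
    exact h3 hab hbc hcd
  have heb : e ≠ b := by
    rintro rfl
    exact h3 hbc hcd hde
  refine h.not_ge (girth_le_length
    (w := .cons hab (.cons hbc (.cons hcd (.cons hde (.cons hea .nil))))) ?_)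
  simp [Walk.cons_isCycle_iff, hab.ne, hab.ne', hbc.ne, hcd.ne, hde.ne, hea.ne, hea.ne', hac,
    hac.symm, hbd, hce, hda, hda.symm, heb.symm]

end SimpleGraph

section Hexagons

variable {V : Type*} {Γ : SimpleGraph V}

theorem hexagonPairs_swap (v a b : V) :
    hexagonPairs Γ v b a = Prod.swap '' hexagonPairs Γ v a b := by
  have key {a b p q : V} (h : (p, q) ∈ hexagonPairs Γ v a b) : (q, p) ∈ hexagonPairs Γ v b a := by
    obtain ⟨h1, h2, h3, h4, x, hx, hx'⟩ := h
    exact ⟨h3, h4, h1, h2, x, hx'.symm, hx.symm⟩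
  ext ⟨p, q⟩
  refine ⟨fun h => ⟨(q, p), key h, rfl⟩, ?_⟩
  rintro ⟨⟨q', p'⟩, h, h'⟩
  obtain ⟨rfl, rfl⟩ := Prod.mk.inj h'
  exact key h

theorem ncard_hexagonPairs_comm (v a b : V) :
    (hexagonPairs Γ v b a).ncard = (hexagonPairs Γ v a b).ncard := by
  rw [hexagonPairs_swap, Set.ncard_image_of_injective _ Prod.swap_injective]

/-- The vertices `p, x, q, b` that complete the edge `v, a` to a closed walk `v, a, p, x, q, b`
of length six without backtracking at `v`, `a` and `b`. -/
def hexagonPaths (Γ : SimpleGraph V) (v a : V) : Set (V × V × V × V) :=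
  {(p, x, q, b) | Γ.Adj v b ∧ b ≠ a ∧ Γ.Adj a p ∧ p ≠ v ∧ Γ.Adj b q ∧ q ≠ v ∧
    Γ.Adj p x ∧ Γ.Adj x q}

/-- The edges of the hexagon through the edge `v, a` and the path `p, x, q, b`. -/
def hexagonEdges (v a : V) : V × V × V × V → Set (Sym2 V) :=
  fun (p, x, q, b) => {s(v, a), s(a, p), s(p, x), s(x, q), s(q, b), s(b, v)}

theorem exists_hexagonPaths_of_isCycle {v a : V} {w : Γ.Walk v v} (hw : w.IsCycle)
    (hl : w.length = 6) (ha : s(v, a) ∈ w.edges) :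
    ∃ z ∈ hexagonPaths Γ v a, hexagonEdges v a z = {e | e ∈ w.edges} := by
  obtain _ | ⟨h0, w⟩ := w
  · simp at hl
  obtain _ | ⟨h1, w⟩ := w
  · simp at hl
  obtain _ | ⟨h2, w⟩ := w
  · simp at hl
  obtain _ | ⟨h3, w⟩ := w
  · simp at hl
  obtain _ | ⟨h4, w⟩ := w
  · simp at hl
  obtain _ | ⟨h5, w⟩ := w
  · simp at hl
  obtain _ | ⟨h6, w⟩ := w
  swap
  · simp at hl
  rename_i u1 u2 u3 u4 u5
  have hnd := hw.support_nodup
  simp only [SimpleGraph.Walk.support_cons, SimpleGraph.Walk.support_nil, List.tail_cons,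
    List.nodup_cons, List.mem_cons, List.not_mem_nil, or_false, not_or] at hnd
  have ha' : a = u1 ∨ a = u5 := by
    simp only [SimpleGraph.Walk.edges_cons, SimpleGraph.Walk.edges_nil, List.mem_cons,
      List.not_mem_nil, or_false, Sym2.eq_iff] at ha
    grind
  rcases ha' with rfl | rfl
  · refine ⟨(u2, u3, u4, u5), ⟨h5.symm, by grind, h1, by grind, h4.symm, by grind, h2, h3⟩, ?_⟩
    ext e
    simp [hexagonEdges]
  · refine ⟨(u4, u3, u2, u1), ⟨h0, by grind, h4.symm, by grind, h1, by grind, h3.symm, h2.symm⟩, ?_⟩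
    ext e
    simp only [hexagonEdges, Set.mem_insert_iff, Set.mem_singleton_iff, Set.mem_ofPred_eq,
      SimpleGraph.Walk.edges_cons, SimpleGraph.Walk.edges_nil, List.mem_cons, List.not_mem_nil,
      or_false]
    grind [Sym2.eq_swap]

theorem hexagonPaths_ne (hg : 5 < Γ.girth) {v a p x q b : V} (hva : Γ.Adj v a)
    (h : (p, x, q, b) ∈ hexagonPaths Γ v a) :
    [v, a, p, x, q, b].Nodup := by
  have h3 {a b c : V} : Γ.Adj a b → Γ.Adj b c → ¬ Γ.Adj c a :=
    SimpleGraph.not_adj_of_three_lt_girth (by omega)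
  have h4 {a b x y : V} : Γ.Adj a x → Γ.Adj x b → Γ.Adj a y → Γ.Adj y b → a ≠ b → x = y :=
    SimpleGraph.eq_of_adj_of_four_lt_girth (by omega)
  obtain ⟨hvb, hba, hap, hpv, hbq, hqv, hpx, hxq⟩ := h
  have hax : a ≠ x := by
    rintro rfl
    exact hba (h4 hvb hbq hva hxq hqv.symm)
  have hxb : x ≠ b := by
    rintro rfl
    exact hba (h4 hvb hpx.symm hva hap hpv.symm)
  have hpq : p ≠ q := by
    rintro rfl
    exact hba (h4 hvb hbq hva hap hpv.symm)
  have hvx : v ≠ x := by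
    rintro rfl
    exact h3 hva hap hpx
  have haq : a ≠ q := by
    rintro rfl
    exact h3 hva hbq.symm hvb.symm
  have hpb : p ≠ b := by
    rintro rfl
    exact h3 hva hap hvb.symm
  simp only [List.nodup_cons, List.mem_cons, List.not_mem_nil, or_false, not_or,
    not_false_eq_true, List.nodup_nil, and_true]
  exact ⟨⟨hva.ne, hpv.symm, hvx, hqv.symm, hvb.ne⟩, ⟨hap.ne, hax, haq, hba.symm⟩,
    ⟨hpx.ne, hpq, hpb⟩, ⟨hxq.ne, hxb⟩, hbq.ne'⟩

theorem exists_isCycle_of_hexagonPaths (hg : 5 < Γ.girth) {v a : V} (hva : Γ.Adj v a)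
    {z : V × V × V × V} (hz : z ∈ hexagonPaths Γ v a) :
    ∃ w : Γ.Walk v v, w.IsCycle ∧ w.length = 6 ∧ hexagonEdges v a z = {e | e ∈ w.edges} := by
  obtain ⟨p, x, q, b⟩ := z
  have hnd := hexagonPaths_ne hg hva hz
  obtain ⟨hvb, hba, hap, hpv, hbq, hqv, hpx, hxq⟩ := hz
  refine ⟨.cons hva (.cons hap (.cons hpx (.cons hxq (.cons hbq.symm (.cons hvb.symm .nil))))),
    ?_, rfl, ?_⟩
  · simp only [List.nodup_cons, List.mem_cons, List.not_mem_nil, or_false, not_or,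
      not_false_eq_true, List.nodup_nil, and_true] at hnd
    simp [SimpleGraph.Walk.cons_isCycle_iff]
    grind
  · ext e
    simp [hexagonEdges]

theorem hexagonEdges_injOn (hg : 5 < Γ.girth) {v a : V} (hva : Γ.Adj v a) :
    Set.InjOn (hexagonEdges v a) (hexagonPaths Γ v a) := by
  rintro ⟨p, x, q, b⟩ hz ⟨p', x', q', b'⟩ hz' h
  have hnd := hexagonPaths_ne hg hva hz
  have hnd' := hexagonPaths_ne hg hva hz'
  simp only [List.nodup_cons, List.mem_cons, List.not_mem_nil, or_false, not_or,
      not_false_eq_true, List.nodup_nil, and_true] at hnd hnd'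
  have hmem (e : Sym2 V) (he : e ∈ hexagonEdges v a (p, x, q, b)) :
    e ∈ hexagonEdges v a (p', x', q', b') := h ▸ he
  simp only [hexagonEdges, Set.mem_insert_iff, Set.mem_singleton_iff] at hmem
  have h1 := hmem s(a, p) (by simp)
  have h2 := hmem s(p, x) (by simp)
  have h3 := hmem s(x, q) (by simp)
  have h4 := hmem s(b, v) (by simp)
  simp only [Sym2.eq_iff] at h1 h2 h3 h4
  grind

theorem sixCycleCount_eq_ncard_hexagonPaths (hg : 5 < Γ.girth) {v a : V} (hva : Γ.Adj v a) :
    sixCycleCount Γ s(v, a) = (hexagonPaths Γ v a).ncard := by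
  classical
  rw [← (hexagonEdges_injOn hg hva).ncard_image, sixCycleCount]
  congr 1
  ext S
  constructor
  · rintro ⟨⟨u, w, hw, hl, rfl⟩, he⟩
    have hv : v ∈ w.support := w.fst_mem_support_of_mem_edges he
    have hrot (e : Sym2 V) := (w.rotate_edges v hv).mem_iff (a := e)
    obtain ⟨z, hz, hze⟩ := exists_hexagonPaths_of_isCycle (hw.rotate hv)
      ((w.length_rotate v hv).trans hl) ((hrot _).2 he)
    refine ⟨z, hz, hze.trans ?_⟩
    ext e
    exact hrot e
  · rintro ⟨z, hz, rfl⟩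
    obtain ⟨w, hw, hl, he⟩ := exists_isCycle_of_hexagonPaths hg hva hz
    refine ⟨⟨v, w, hw, hl, he⟩, ?_⟩
    simp [hexagonEdges]

theorem ncard_hexagonPaths [Finite V] (hg : 5 < Γ.girth) {v a b c : V} (hab : a ≠ b) (hac : a ≠ c)
    (hbc : b ≠ c) (hN : ∀ u, Γ.Adj v u ↔ u = a ∨ u = b ∨ u = c) :
    (hexagonPaths Γ v a).ncard =
      (hexagonPairs Γ v a b).ncard + (hexagonPairs Γ v a c).ncard := by
  have hva : Γ.Adj v a := by simp [hN]
  have hinj : Set.InjOn (fun z : V × V × V × V => ((z.1, z.2.2.1), z.2.2.2))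
      (hexagonPaths Γ v a) := by
    rintro ⟨p, x, q, b⟩ hz ⟨p', x', q', b'⟩ hz' h
    have hnd := hexagonPaths_ne hg hva hz
    simp only [Prod.mk.injEq] at h
    obtain ⟨⟨rfl, rfl⟩, rfl⟩ := h
    obtain ⟨-, -, -, -, -, -, h1, h2⟩ := hz
    obtain ⟨-, -, -, -, -, -, h1', h2'⟩ := hz'
    rw [SimpleGraph.eq_of_adj_of_four_lt_girth (by omega) h1 h2 h1' h2' (by grind)]
  have himage : (fun z : V × V × V × V => ((z.1, z.2.2.1), z.2.2.2)) '' hexagonPaths Γ v a =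
      hexagonPairs Γ v a b ×ˢ {b} ∪ hexagonPairs Γ v a c ×ˢ {c} := by
    ext ⟨⟨p, q⟩, d⟩
    constructor
    · rintro ⟨⟨p', x, q', d'⟩, ⟨h1, h2, h3, h4, h5, h6, h7, h8⟩, h⟩
      simp only [Prod.mk.injEq] at h
      obtain ⟨⟨rfl, rfl⟩, rfl⟩ := h
      rcases (hN d').1 h1 with rfl | rfl | rfl
      · exact absurd rfl h2
      · exact .inl ⟨⟨h3, h4, h5, h6, x, h7, h8⟩, rfl⟩
      · exact .inr ⟨⟨h3, h4, h5, h6, x, h7, h8⟩, rfl⟩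
    · rintro (⟨⟨h3, h4, h5, h6, x, h7, h8⟩, hd⟩ | ⟨⟨h3, h4, h5, h6, x, h7, h8⟩, hd⟩)
      all_goals
        replace hd : d = _ := hd
      · exact ⟨(p, x, q, d), ⟨by simp [hN, hd], by grind, h3, h4, hd ▸ h5, h6, h7, h8⟩, rfl⟩
      · exact ⟨(p, x, q, d), ⟨by simp [hN, hd], by grind, h3, h4, hd ▸ h5, h6, h7, h8⟩, rfl⟩
  rw [← hinj.ncard_image, himage, Set.ncard_union_eq ?_ (Set.toFinite _) (Set.toFinite _),
    Set.ncard_prod, Set.ncard_prod, Set.ncard_singleton, Set.ncard_singleton, mul_one, mul_one]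
  exact Set.disjoint_prod.2 (.inr (by simpa using hbc))

end Hexagons

theorem hasSignature.exists_isHexColouring {V : Type*} [Finite V] {Γ : SimpleGraph V}
    [Nonempty V] (hcubic : ∀ v : V, (Γ.neighborSet v).ncard = 3) (hg : 5 < Γ.girth) {a : ℕ}
    (ha : a ≤ 5) (hsig : hasSignature Γ a 5 5) :
    ∃ t col, a = 2 * t ∧ IsHexColouring Γ t col := by
  have local_structure (v : V) : ∃ x y z, x ≠ y ∧ x ≠ z ∧ y ≠ z ∧
      (∀ u, Γ.Adj v u ↔ u = x ∨ u = y ∨ u = z) ∧ sixCycleCount Γ s(v, x) = a ∧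
      sixCycleCount Γ s(v, y) = 5 ∧ sixCycleCount Γ s(v, z) = 5 ∧
      a = 2 * (hexagonPairs Γ v x y).ncard ∧
      (hexagonPairs Γ v x z).ncard = (hexagonPairs Γ v x y).ncard ∧
      (hexagonPairs Γ v y z).ncard = 5 - (hexagonPairs Γ v x y).ncard := by
    obtain ⟨e₁, e₂, e₃, h12, h13, h23, hinc, h1, h2, h3⟩ := hsig v
    have hend (e : Sym2 V) (he : e ∈ Γ.incidenceSet v) : ∃ x, s(v, x) = e :=
      ⟨_, Sym2.other_spec he.2⟩
    obtain ⟨x, rfl⟩ := hend e₁ (by simp [hinc])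
    obtain ⟨y, rfl⟩ := hend e₂ (by simp [hinc])
    obtain ⟨z, rfl⟩ := hend e₃ (by simp [hinc])
    rw [Ne, Sym2.congr_right] at h12 h13 h23
    have hN (u : V) : Γ.Adj v u ↔ u = x ∨ u = y ∨ u = z := by
      rw [← Γ.mem_incidenceSet, hinc]
      simp only [Set.mem_insert_iff, Set.mem_singleton_iff, Sym2.congr_right]
    have hx := ncard_hexagonPaths hg h12 h13 h23 hN
    have hy := ncard_hexagonPaths hg (Ne.symm h12) h23 h13 fun u => (hN u).trans or_left_comm
    have hz := ncard_hexagonPaths hg (Ne.symm h13) (Ne.symm h23) h12 fun u => by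
      rw [hN]; tauto
    rw [← sixCycleCount_eq_ncard_hexagonPaths hg (by simp [hN])] at hx hy hz
    rw [ncard_hexagonPairs_comm v x y] at hy
    rw [ncard_hexagonPairs_comm v x z, ncard_hexagonPairs_comm v y z] at hz
    exact ⟨x, y, z, h12, h13, h23, hN, h1, h2, h3, by omega, by omega, by omega⟩
  have heven : a = 2 * (a / 2) := by
    obtain ⟨v⟩ := ‹Nonempty V›
    obtain ⟨x, y, z, -, -, -, -, -, -, -, h, -⟩ := local_structure v
    omega
  refine ⟨a / 2, fun u v => decide (sixCycleCount Γ s(u, v) ≠ 5), heven, ?_⟩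
  refine ⟨SimpleGraph.not_adj_of_three_lt_girth (by omega),
    SimpleGraph.eq_of_adj_of_four_lt_girth (by omega), SimpleGraph.not_adj_of_five_lt_girth hg,
    fun u v => by rw [Sym2.eq_swap], hcubic, fun v c => ?_, fun {v b c} hb hc hbc => ?_⟩
  · obtain ⟨x, y, z, hxy, hxz, hyz, hN, hx, hy, hz, -⟩ := local_structure v
    cases c with
    | true =>
      have : {u | Γ.Adj v u ∧ decide (sixCycleCount Γ s(v, u) ≠ 5) = true} = {x} := by
        ext u
        simp only [Set.mem_ofPred_eq, hN, decide_eq_true_eq, Set.mem_singleton_iff]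
        grind
      rw [this, Set.ncard_singleton]
      rfl
    | false =>
      have : {u | Γ.Adj v u ∧ decide (sixCycleCount Γ s(v, u) ≠ 5) = false} = {y, z} := by
        ext u
        simp only [Set.mem_ofPred_eq, hN, decide_eq_false_iff_not, Set.mem_insert_iff,
          Set.mem_singleton_iff]
        grind
      rw [this, Set.ncard_pair hyz]
      rfl
  · obtain ⟨x, y, z, hxy, hxz, hyz, hN, hx, hy, hz, h1, h2, h3⟩ := local_structure v
    have hx5 : sixCycleCount Γ s(v, x) ≠ 5 := by omega
    have h1' := ncard_hexagonPairs_comm (Γ := Γ) v x y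
    have h2' := ncard_hexagonPairs_comm (Γ := Γ) v x z
    have h3' := ncard_hexagonPairs_comm (Γ := Γ) v y z
    rcases (hN b).1 hb with rfl | rfl | rfl <;> rcases (hN c).1 hc with rfl | rfl | rfl <;>
      first
      | exact absurd rfl hbc
      | simp [hexagonWeight, hx5, hy, hz]
        omega

/-- A finite connected simple cubic vertex-transitive graph of girth 6
with signature `(a, 5, 5)` has `a = 4` and is isomorphic to `Ψ_9`. -/
theorem cubic_vt_girth_six_signature_b_eq_c_eq_five {V : Type*} [Fintype V] (Γ : SimpleGraph V)
    (hconn : Γ.Connected)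
    (hcubic : ∀ v : V, (Γ.neighborSet v).ncard = 3)
    (hvt : ∀ u v : V, ∃ φ : Γ ≃g Γ, φ u = v)
    (hgirth : Γ.girth = 6)
    (a : ℕ) (ha : a ≤ 5)
    (hsig : hasSignature Γ a 5 5) :
    a = 4 ∧ Nonempty (Γ ≃g psiGraph 9) := by
  have := hconn.nonempty
  obtain ⟨t, col, rfl, hcol⟩ := hsig.exists_isHexColouring hcubic (by omega) ha
  obtain ⟨rfl, hiso⟩ := hcol.eq_two_and_nonempty_iso (by omega) hconn
  exact ⟨rfl, hiso⟩
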